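/- Let n, m ≥ 1, let x ∈ ℝⁿ, z ∈ ℝᵐ, and let p ∈ ℝⁿ and q ∈ ℝᵐ denote the partial gradients ∇ₓd(x,z) and ∇_z d(x,z) of a goal-conditioned cost-to-go d at (x,z). Suppose the mode-local Hamilton–Jacobi–Bellman equation for the isotropic controllable dynamics ẋ = u with ‖u‖ ≤ 1, ż = 0 and unit running cost holds at (x,z), i.e. inf over u in the closed unit ball of ℝⁿ of (1 + ⟨p, u⟩) equals 0, and suppose the full-state Eikonal equation ‖p‖² + ‖q‖² = 1 also holds at (x,z). Then q = 0. Equivalently, if q ≠ 0 then the mode-local HJB equation and the full-state Eikonal equation cannot both hold at (x,z). -/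

import Mathlib

open scoped RealInnerProductSpace

/-- The affine functional `u ↦ 1 + ⟪p, u⟫` attains its minimum `1 - ‖p‖` over the closed unit
ball. -/
theorem isLeast_one_add_inner_image_closedBall {E : Type*} [NormedAddCommGroup E]
    [InnerProductSpace ℝ E] (p : E) :
    IsLeast ((fun u : E => 1 + ⟪p, u⟫) '' Metric.closedBall (0 : E) 1) (1 - ‖p‖) := by
  constructor
  · refine ⟨-(‖p‖⁻¹ • p), ?_, ?_⟩
    · rw [mem_closedBall_zero_iff, norm_neg, norm_smul, norm_inv, norm_norm]
      exact inv_mul_le_one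
    · rcases eq_or_ne p 0 with rfl | hp
      · simp
      · have : ‖p‖ ≠ 0 := norm_ne_zero_iff.mpr hp
        simp only [inner_neg_right, real_inner_smul_right, real_inner_self_eq_norm_sq]
        field_simp
        ring
  · rintro _ ⟨u, hu, rfl⟩
    rw [mem_closedBall_zero_iff] at hu
    have hinner : -(‖p‖ * ‖u‖) ≤ ⟪p, u⟫ := (abs_le.mp (abs_real_inner_le_norm p u)).1
    have hmul : ‖p‖ * ‖u‖ ≤ ‖p‖ := mul_le_of_le_one_right (norm_nonneg p) hu
    change 1 - ‖p‖ ≤ 1 + ⟪p, u⟫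
    linarith

/-- **Proposition 1 (Eikonal mismatch under locally uncontrollable coordinates).**
In a fixed mode with controllable coordinates `x ∈ ℝⁿ` (dynamics `ẋ = u`, `‖u‖ ≤ 1`)
and locally uncontrollable coordinates `z ∈ ℝᵐ` (`ż = 0`), unit running cost, if at
`(x, z)` the mode-local HJB equation
`inf_{‖u‖ ≤ 1} (1 + ⟨p, u⟩) = 0` holds (where `p = ∇ₓ d(x,z)`, `q = ∇_z d(x,z)`)
and the full-state Eikonal equation `‖p‖² + ‖q‖² = 1` also holds, then `q = 0`. -/
theorem eikonal_mismatch_under_locally_uncontrollable_coordinates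
    (n m : ℕ) (hn : 1 ≤ n) (hm : 1 ≤ m)
    (x : EuclideanSpace ℝ (Fin n)) (z : EuclideanSpace ℝ (Fin m))
    (p : EuclideanSpace ℝ (Fin n)) (q : EuclideanSpace ℝ (Fin m))
    (hHJB : sInf ((fun u : EuclideanSpace ℝ (Fin n) => 1 + ⟪p, u⟫) ''
      Metric.closedBall (0 : EuclideanSpace ℝ (Fin n)) 1) = 0)
    (hEik : ‖p‖ ^ 2 + ‖q‖ ^ 2 = 1) :
    q = 0 := by
  rw [(isLeast_one_add_inner_image_closedBall p).csInf_eq] at hHJB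
  have hp : ‖p‖ = 1 := by linarith
  rw [hp] at hEik
  have hq : ‖q‖ ^ 2 = 0 := by linarith
  simpa using hq
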